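/- Let a⁻, a⁺ : ℝ^d → [0,∞) be integrable, and for α' < α define the operator L̂₁ on functions over finite configurations by (L̂₁G)(η) = −∑_{x∈η} ∑_{y∈η\x} a⁻(x−y) G(η\x) + ∑_{x∈η} ∫_{ℝ^d} a⁺(x−y) G((η\x)∪y) dy. Then L̂₁ is bounded from L_α to L_{α'} with ‖L̂₁‖ ≤ (‖a⁻‖_{L¹} e^{α} + ‖a⁺‖_{L¹})/(e(α−α')). -/

import Mathlib

open Nat MeasureTheory ENNReal

/-- The operator `L̂₁` of Lemma 5.3(a) in Lebesgue–Poisson coordinates: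
`(L̂₁G)(η) = −∑_{x∈η}∑_{y∈η\x} a⁻(x−y) G(η\x) + ∑_{x∈η} ∫ a⁺(x−y) G((η\x)∪y) dy`. -/
noncomputable def L1hat (d : ℕ) (am ap : (Fin d → ℝ) → ℝ)
    (G : (n : ℕ) → (Fin n → (Fin d → ℝ)) → ℝ) :
    (n : ℕ) → (Fin n → (Fin d → ℝ)) → ℝ
  | 0 => fun _ => 0
  | (n + 1) => fun x =>
      -(∑ i : Fin (n + 1), ∑ j ∈ Finset.univ.erase i,
          am (x i - x j) * G n (x ∘ i.succAbove)) +
        ∑ i : Fin (n + 1), ∫ y : Fin d → ℝ,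
          ap (x i - y) * G (n + 1) (Function.update x i y)

theorem lintegral_eq_lintegral_insertNth {E : Type*} [MeasureSpace E]
    [SigmaFinite (volume : Measure E)] {n : ℕ} (i : Fin (n + 1))
    {f : (Fin (n + 1) → E) → ℝ≥0∞} (hf : AEMeasurable f) :
    ∫⁻ x, f x = ∫⁻ r : Fin n → E, ∫⁻ a : E, f (i.insertNth a r) := by
  have hmp := (volume_preserving_piFinSuccAbove (fun _ : Fin (n + 1) => E) i).symm
  rw [← hmp.lintegral_comp_emb (MeasurableEquiv.measurableEmbedding _) f]
  exact lintegral_prod_symm _ (hf.comp_quasiMeasurePreserving hmp.quasiMeasurePreserving)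

section Translation

variable {E : Type*} [AddCommGroup E] [MeasureSpace E] [MeasurableAdd₂ E] [MeasurableNeg E]

theorem measurable_sub_mul_update {n : ℕ} (i : Fin (n + 1)) {p : E → ℝ≥0∞} (hp : Measurable p)
    {g : (Fin (n + 1) → E) → ℝ≥0∞} (hg : Measurable g) :
    Measurable fun z : (Fin (n + 1) → E) × E =>
      p (z.1 i - z.2) * g (Function.update z.1 i z.2) := by
  have hm : Measurable fun z : (Fin (n + 1) → E) × E => Function.update z.1 i z.2 := by
    refine measurable_pi_lambda _ fun k => ?_
    rcases eq_or_ne k i with rfl | hk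
    · simpa using measurable_snd
    · simp only [Function.update_of_ne hk]
      fun_prop
  exact (hp.comp (by fun_prop)).mul (hg.comp hm)

variable [SigmaFinite (volume : Measure E)] [(volume : Measure E).IsAddLeftInvariant]

theorem quasiMeasurePreserving_apply_sub_apply {n : ℕ} {i j : Fin (n + 1)} (hij : j ≠ i) :
    Measure.QuasiMeasurePreserving (fun x : Fin (n + 1) → E => x i - x j) := by
  obtain ⟨k, rfl⟩ := Fin.exists_succAbove_eq hij
  have hmp := volume_preserving_piFinSuccAbove (fun _ : Fin (n + 1) => E) i
  have h : Measure.QuasiMeasurePreserving (fun p : E × (Fin n → E) => p.1 - p.2 k)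
      (volume.prod volume) volume :=
    QuasiMeasurePreserving.prod_of_left (by fun_prop)
      (.of_forall fun r => (measurePreserving_sub_right volume (r k)).quasiMeasurePreserving)
  exact h.comp hmp.quasiMeasurePreserving

theorem aemeasurable_sub_mul_comp_succAbove {n : ℕ} {i j : Fin (n + 1)} (hij : j ≠ i)
    {h : E → ℝ≥0∞} (hh : AEMeasurable h) {g : (Fin n → E) → ℝ≥0∞} (hg : Measurable g) :
    AEMeasurable (fun x : Fin (n + 1) → E => h (x i - x j) * g (x ∘ i.succAbove)) := by
  have hm : Measurable fun x : Fin (n + 1) → E => x ∘ i.succAbove :=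
    measurable_pi_lambda _ fun k => measurable_pi_apply _
  exact (hh.comp_quasiMeasurePreserving (quasiMeasurePreserving_apply_sub_apply hij)).mul
    (hg.comp hm).aemeasurable

theorem lintegral_sub_mul_comp_succAbove {n : ℕ} {i j : Fin (n + 1)} (hij : j ≠ i)
    {h : E → ℝ≥0∞} (hh : AEMeasurable h) {g : (Fin n → E) → ℝ≥0∞} (hg : Measurable g) :
    ∫⁻ x : Fin (n + 1) → E, h (x i - x j) * g (x ∘ i.succAbove) =
      (∫⁻ z, h z) * ∫⁻ r, g r := by
  rw [lintegral_eq_lintegral_insertNth i (aemeasurable_sub_mul_comp_succAbove hij hh hg),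
    ← lintegral_const_mul _ hg]
  obtain ⟨k, rfl⟩ := Fin.exists_succAbove_eq hij
  refine lintegral_congr fun r => ?_
  simp only [Fin.insertNth_apply_same, Fin.insertNth_apply_succAbove,
    Fin.insertNth_comp_succAbove]
  have hr : AEMeasurable fun a => h (a - r k) := hh.comp_quasiMeasurePreserving
    (measurePreserving_sub_right volume (r k)).quasiMeasurePreserving
  rw [lintegral_mul_const'' _ hr, lintegral_sub_right_eq_self]

theorem lintegral_sub_mul_update_congr {n : ℕ} (i : Fin (n + 1)) {p q : E → ℝ≥0∞}
    (hpq : p =ᵐ[volume] q) (g : (Fin (n + 1) → E) → ℝ≥0∞) (x : Fin (n + 1) → E) :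
    ∫⁻ y : E, p (x i - y) * g (Function.update x i y) =
      ∫⁻ y : E, q (x i - y) * g (Function.update x i y) := by
  refine lintegral_congr_ae ?_
  filter_upwards [(quasiMeasurePreserving_sub_left volume (x i)).ae hpq] with y hy
  rw [hy]

theorem measurable_lintegral_sub_mul_update {n : ℕ} (i : Fin (n + 1)) {p : E → ℝ≥0∞}
    (hp : AEMeasurable p) {g : (Fin (n + 1) → E) → ℝ≥0∞} (hg : Measurable g) :
    Measurable fun x : Fin (n + 1) → E =>
      ∫⁻ y : E, p (x i - y) * g (Function.update x i y) := by
  simp_rw [lintegral_sub_mul_update_congr i hp.ae_eq_mk g]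
  exact (measurable_sub_mul_update i hp.measurable_mk hg).lintegral_prod_right'

theorem lintegral_lintegral_sub_mul_update {n : ℕ} (i : Fin (n + 1)) {p : E → ℝ≥0∞}
    (hp : AEMeasurable p) {g : (Fin (n + 1) → E) → ℝ≥0∞} (hg : Measurable g) :
    ∫⁻ x : Fin (n + 1) → E, ∫⁻ y : E, p (x i - y) * g (Function.update x i y) =
      (∫⁻ z, p z) * ∫⁻ x, g x := by
  have hins (r : Fin n → E) : Measurable fun a : E => i.insertNth (α := fun _ => E) a r :=
    (volume_preserving_piFinSuccAbove (fun _ : Fin (n + 1) => E) i).symm.measurable.comp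
      (measurable_id.prodMk measurable_const)
  rw [lintegral_eq_lintegral_insertNth i
      (measurable_lintegral_sub_mul_update i hp hg).aemeasurable,
    lintegral_eq_lintegral_insertNth i hg.aemeasurable, lintegral_congr_ae hp.ae_eq_mk,
    ← lintegral_const_mul]
  · refine lintegral_congr fun r => ?_
    simp_rw [lintegral_sub_mul_update_congr i hp.ae_eq_mk g]
    simp only [Fin.insertNth_apply_same, Fin.update_insertNth]
    have hpm := hp.measurable_mk
    have hgr : Measurable fun a => g (i.insertNth a r) := hg.comp (hins r)
    rw [lintegral_lintegral_swap, ← lintegral_const_mul _ hgr]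
    · refine lintegral_congr fun y => ?_
      rw [lintegral_mul_const _ (by fun_prop), lintegral_sub_right_eq_self]
    · exact ((hpm.comp (measurable_fst.sub measurable_snd)).mul
        (hgr.comp measurable_snd)).aemeasurable
  · exact (hg.comp (volume_preserving_piFinSuccAbove
      (fun _ : Fin (n + 1) => E) i).symm.measurable).lintegral_prod_left'

end Translation

theorem lintegral_enorm_L1hat_succ_le (d : ℕ) {am ap : (Fin d → ℝ) → ℝ}
    (hami : AEMeasurable am) (hapi : AEMeasurable ap)
    {G : (n : ℕ) → (Fin n → (Fin d → ℝ)) → ℝ} (hG : ∀ n, Measurable (G n)) (n : ℕ) :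
    ∫⁻ x, ‖L1hat d am ap G (n + 1) x‖ₑ ≤
      (n + 1) * (n * ((∫⁻ z, ‖am z‖ₑ) * ∫⁻ x, ‖G n x‖ₑ)) +
        (n + 1) * ((∫⁻ z, ‖ap z‖ₑ) * ∫⁻ x, ‖G (n + 1) x‖ₑ) := by
  have hpair (i j : Fin (n + 1)) (hj : j ∈ Finset.univ.erase i) :=
    aemeasurable_sub_mul_comp_succAbove (Finset.ne_of_mem_erase hj) hami.enorm (hG n).enorm
  calc ∫⁻ x, ‖L1hat d am ap G (n + 1) x‖ₑ
      ≤ ∫⁻ x : Fin (n + 1) → (Fin d → ℝ),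
          ((∑ i : Fin (n + 1), ∑ j ∈ Finset.univ.erase i,
            ‖am (x i - x j)‖ₑ * ‖G n (x ∘ i.succAbove)‖ₑ) +
          ∑ i : Fin (n + 1), ∫⁻ y : Fin d → ℝ,
            ‖ap (x i - y)‖ₑ * ‖G (n + 1) (Function.update x i y)‖ₑ) := by
        refine lintegral_mono fun x => (enorm_add_le _ _).trans ?_
        rw [enorm_neg]
        simp_rw [← enorm_mul]
        gcongr
        · exact (enorm_sum_le _ _).trans (Finset.sum_le_sum fun i _ => enorm_sum_le _ _)
        · exact (enorm_sum_le _ _).trans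
            (Finset.sum_le_sum fun i _ => enorm_integral_le_lintegral_enorm _)
    _ = _ := by
        rw [lintegral_add_left' (Finset.aemeasurable_fun_sum _ fun i _ =>
            Finset.aemeasurable_fun_sum _ (hpair i)),
          lintegral_finsetSum' _ (fun i _ => Finset.aemeasurable_fun_sum _ (hpair i)),
          lintegral_finsetSum' _ (fun i _ =>
            (measurable_lintegral_sub_mul_update i hapi.enorm (hG (n + 1)).enorm).aemeasurable)]
        congr 1
        · rw [Finset.sum_congr rfl fun i _ => (lintegral_finsetSum' _ (hpair i)).trans
            (Finset.sum_congr rfl fun j hj => lintegral_sub_mul_comp_succAbove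
              (Finset.ne_of_mem_erase hj) hami.enorm (hG n).enorm)]
          simp
        · rw [Finset.sum_congr rfl fun i _ =>
            lintegral_lintegral_sub_mul_update i hapi.enorm (hG (n + 1)).enorm]
          simp

theorem natCast_mul_exp_le {α α' : ℝ} (hα : α' < α) (n : ℕ) :
    n * Real.exp (α' * n) ≤ (Real.exp 1 * (α - α'))⁻¹ * Real.exp (α * n) := by
  have hpos : 0 < α - α' := sub_pos.mpr hα
  have h := Real.add_one_le_exp ((α - α') * n - 1)
  rw [sub_add_cancel, Real.exp_sub, le_div_iff₀ (Real.exp_pos 1)] at h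
  rw [← div_eq_inv_mul, le_div_iff₀ (by positivity)]
  calc n * Real.exp (α' * n) * (Real.exp 1 * (α - α'))
      = (α - α') * n * Real.exp 1 * Real.exp (α' * n) := by ring
    _ ≤ Real.exp ((α - α') * n) * Real.exp (α' * n) := by gcongr
    _ = Real.exp (α * n) := by rw [← Real.exp_add]; ring_nf

theorem natCast_mul_ofReal_exp_le {α α' : ℝ} (hα : α' < α) (n : ℕ) :
    (n : ℝ≥0∞) * ENNReal.ofReal (Real.exp (α' * n)) ≤
      ENNReal.ofReal (Real.exp 1 * (α - α'))⁻¹ * ENNReal.ofReal (Real.exp (α * n)) := by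
  have hpos : 0 < α - α' := sub_pos.mpr hα
  rw [← ENNReal.ofReal_natCast, ← ENNReal.ofReal_mul (by positivity),
    ← ENNReal.ofReal_mul (by positivity)]
  exact ENNReal.ofReal_le_ofReal (natCast_mul_exp_le hα n)

theorem lintegral_ofReal_abs_mul {X : Type*} [MeasurableSpace X] (μ : Measure X) (f : X → ℝ)
    (c : ℝ) : ∫⁻ x, ENNReal.ofReal (|f x| * c) ∂μ = ENNReal.ofReal c * ∫⁻ x, ‖f x‖ₑ ∂μ := by
  rw [← lintegral_const_mul' _ _ ENNReal.ofReal_ne_top]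
  refine lintegral_congr fun x => ?_
  rw [ENNReal.ofReal_mul (abs_nonneg _), mul_comm, ← Real.norm_eq_abs, ofReal_norm]

theorem inv_factorial_succ_mul (n : ℕ) :
    (((n + 1)! : ℕ) : ℝ≥0∞)⁻¹ * (n + 1) = (n ! : ℝ≥0∞)⁻¹ := by
  rw [Nat.factorial_succ, Nat.cast_mul, ENNReal.mul_inv (by simp) (by simp), mul_right_comm,
    Nat.cast_succ, ENNReal.inv_mul_cancel (by simp) (by simp), one_mul]

/-- Lemma 5.3(a), second inequality: for integrable `a⁻, a⁺ ≥ 0` and `α' < α`,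
`L̂₁` is bounded from `L_α` to `L_{α'}` with
`‖L̂₁‖ ≤ (‖a⁻‖_{L¹} e^α + ‖a⁺‖_{L¹})/(e(α−α'))`, stated here as the
corresponding inequality of Lebesgue–Poisson norms. -/
theorem L1hat_bound (d : ℕ) (am ap : (Fin d → ℝ) → ℝ) (α α' : ℝ) (hα : α' < α)
    (ham0 : ∀ x, 0 ≤ am x) (hap0 : ∀ x, 0 ≤ ap x)
    (hami : Integrable am) (hapi : Integrable ap)
    (G : (n : ℕ) → (Fin n → (Fin d → ℝ)) → ℝ)
    (hGmeas : ∀ n, Measurable (G n)) :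
    ∑' n : ℕ, (n ! : ℝ≥0∞)⁻¹ *
        ∫⁻ x : Fin n → (Fin d → ℝ),
          ENNReal.ofReal (|L1hat d am ap G n x| * Real.exp (α' * n)) ≤
      ENNReal.ofReal
          (((∫ x, am x) * Real.exp α + ∫ x, ap x) / (Real.exp 1 * (α - α'))) *
        ∑' n : ℕ, (n ! : ℝ≥0∞)⁻¹ *
          ∫⁻ x : Fin n → (Fin d → ℝ),
            ENNReal.ofReal (|G n x| * Real.exp (α * n)) := by
  simp_rw [lintegral_ofReal_abs_mul]
  have hpos : 0 < α - α' := sub_pos.mpr hα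
  set N : ℕ → ℝ≥0∞ := fun n => ∫⁻ x, ‖G n x‖ₑ
  set A : ℝ≥0∞ := ∫⁻ z, ‖am z‖ₑ with hA
  set P : ℝ≥0∞ := ∫⁻ z, ‖ap z‖ₑ with hP
  set C : ℝ≥0∞ := ENNReal.ofReal (Real.exp 1 * (α - α'))⁻¹
  set S : ℝ≥0∞ := ∑' n : ℕ, (n ! : ℝ≥0∞)⁻¹ * (ENNReal.ofReal (Real.exp (α * n)) * N n)
  set E : ℝ≥0∞ := ENNReal.ofReal (Real.exp α)
  have hconst : ENNReal.ofReal
      (((∫ x, am x) * Real.exp α + ∫ x, ap x) / (Real.exp 1 * (α - α'))) =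
      C * (A * E + P) := by
    have ha := integral_nonneg (μ := volume) (f := am) ham0
    have hp := integral_nonneg (μ := volume) (f := ap) hap0
    rw [div_eq_inv_mul, ENNReal.ofReal_mul (by positivity),
      ENNReal.ofReal_add (by positivity) hp, ENNReal.ofReal_mul ha,
      ofReal_integral_eq_lintegral_ofReal hami (.of_forall ham0),
      ofReal_integral_eq_lintegral_ofReal hapi (.of_forall hap0)]
    simp only [hA, hP, Real.enorm_of_nonneg (ham0 _), Real.enorm_of_nonneg (hap0 _), C, E]
  let u : ℕ → ℝ≥0∞ := fun n =>
    (n ! : ℝ≥0∞)⁻¹ * ((n * ENNReal.ofReal (Real.exp (α' * n))) * N n)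
  have hu : ∑' n, u n ≤ C * S := by
    rw [← ENNReal.tsum_mul_left]
    refine ENNReal.tsum_le_tsum fun n => ?_
    calc u n ≤ (n ! : ℝ≥0∞)⁻¹ * ((C * ENNReal.ofReal (Real.exp (α * n))) * N n) := by
          exact mul_le_mul_right (mul_le_mul_left (natCast_mul_ofReal_exp_le hα n) _) _
      _ = _ := by ring
  have hterm (n : ℕ) : ((n + 1)! : ℝ≥0∞)⁻¹ *
      (ENNReal.ofReal (Real.exp (α' * (n + 1 : ℕ))) * ∫⁻ x, ‖L1hat d am ap G (n + 1) x‖ₑ) ≤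
      A * E * u n + P * u (n + 1) := by
    calc _ ≤ ((n + 1)! : ℝ≥0∞)⁻¹ * (ENNReal.ofReal (Real.exp (α' * (n + 1 : ℕ))) *
          ((n + 1) * (n * (A * N n)) + (n + 1) * (P * N (n + 1)))) := by
          gcongr
          exact lintegral_enorm_L1hat_succ_le d hami.aemeasurable hapi.aemeasurable hGmeas n
      _ = (((n + 1)! : ℝ≥0∞)⁻¹ * (n + 1)) * (ENNReal.ofReal (Real.exp (α' * (n + 1 : ℕ))) *
          (n * (A * N n))) + P * u (n + 1) := by
          simp only [u, Nat.cast_add, Nat.cast_one]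
          ring
      _ ≤ A * E * u n + P * u (n + 1) := by
          refine add_le_add_left ?_ _
          have hexp : ENNReal.ofReal (Real.exp (α' * (n + 1 : ℕ))) ≤
              ENNReal.ofReal (Real.exp (α' * n)) * E := by
            rw [← ENNReal.ofReal_mul (by positivity), ← Real.exp_add]
            gcongr
            push_cast
            linarith
          calc _ ≤ (n ! : ℝ≥0∞)⁻¹ * ((ENNReal.ofReal (Real.exp (α' * n)) * E) *
                (n * (A * N n))) := by
                rw [inv_factorial_succ_mul]
                exact mul_le_mul_right (mul_le_mul_left hexp _) _
            _ = A * E * u n := by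
                dsimp only [u]
                ring
  rw [hconst, tsum_eq_zero_add' ENNReal.summable]
  simp only [L1hat, enorm_zero, lintegral_zero, mul_zero, zero_add]
  calc _ ≤ ∑' n, (A * E * u n + P * u (n + 1)) := ENNReal.tsum_le_tsum hterm
    _ = A * E * ∑' n, u n + P * ∑' n, u (n + 1) := by
        rw [ENNReal.tsum_add, ENNReal.tsum_mul_left, ENNReal.tsum_mul_left]
    _ ≤ A * E * (C * S) + P * (C * S) := by
        gcongr
        exact (ENNReal.tsum_comp_le_tsum_of_injective (add_left_injective 1) u).trans hu
    _ = C * (A * E + P) * S := by ring
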